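/- Let q be even, let T be a simple q-uniform hypergraph on {1,…,v} with edge set E (v ≤ n), and let T₂ be the multi-hypergraph obtained from T by giving every hyperedge multiplicity 2, so m(T₂) = 2|E|. Then b(T₂) = b_T · m(T₂)! / 2^{m(T₂)/2}. -/

import Mathlib

open MeasureTheory Filter

noncomputable section

namespace SYK

attribute [local instance] Classical.propDecidable

/-- The chord crossing sign `K(x,y)`. -/
def K (x y : ℝ × ℝ) : ℝ :=
  if (x.1 < y.1 ∧ y.1 < x.2 ∧ x.2 < y.2) ∨ (y.1 < x.1 ∧ x.1 < y.2 ∧ y.2 < x.2) then -1 else 1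

lemma K_symm (x y : ℝ × ℝ) : K x y = K y x := if_congr or_comm rfl rfl

/-- The law of `(min U₁ U₂, max U₁ U₂)` for `U₁, U₂` i.i.d. uniform on `[0,1]`. -/
def nu : Measure (ℝ × ℝ) :=
  Measure.map (fun p : ℝ × ℝ => (min p.1 p.2, max p.1 p.2))
    (volume.restrict (Set.Icc (0 : ℝ) 1 ×ˢ Set.Icc (0 : ℝ) 1))

/-- Sign contributed by an unordered pair of hyperedges with chords given by `X`. -/
def pairSign {N : ℕ} (X : Finset (Fin N) → ℝ × ℝ) : Sym2 (Finset (Fin N)) → ℝ :=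
  Sym2.lift ⟨fun e₁ e₂ => if Odd (e₁ ∩ e₂).card then K (X e₁) (X e₂) else 1,
    fun e₁ e₂ => if_congr (by rw [Finset.inter_comm]) (K_symm _ _) rfl⟩

/-- `B_H(X)`: the product of `K(X(e₁),X(e₂))` over unordered pairs of distinct
hyperedges sharing an odd number of vertices. -/
def BE {N : ℕ} (E : Finset (Finset (Fin N))) (X : Finset (Fin N) → ℝ × ℝ) : ℝ :=
  ∏ p ∈ E.sym2.filter (fun p => ¬ p.IsDiag), pairSign X p

/-- `b_H`: the expectation of `B_H(X)` over i.i.d. chords with law `ν`. -/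
def bT {N : ℕ} (E : Finset (Finset (Fin N))) : ℝ :=
  ∫ X : Finset (Fin N) → ℝ × ℝ, BE E X ∂(Measure.pi fun _ => nu)

/-- The quadratic form on `ℂ^N` with `Q(x) = ½ Σ x_i²`, so that the Clifford
relation reads `ψ_i ψ_j + ψ_j ψ_i = δ_{ij}`. -/
def Qf (N : ℕ) : QuadraticForm ℂ (Fin N → ℂ) :=
  QuadraticMap.weightedSumSquares ℂ (fun _ : Fin N => (1 / 2 : ℂ))

/-- The complex Clifford algebra with `N` Majorana generators. -/
abbrev Cliff (N : ℕ) := CliffordAlgebra (Qf N)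

/-- The Majorana generator `ψ_i`. -/
def psi {N : ℕ} (i : Fin N) : Cliff N :=
  CliffordAlgebra.ι (Qf N) (Pi.single i 1)

/-- `ψ_I = i^{q/2} ψ_{i₁} ⋯ ψ_{i_q}` for `I = {i₁ < ⋯ < i_q}`. -/
def psiSet {N : ℕ} (q : ℕ) (I : Finset (Fin N)) : Cliff N :=
  (Complex.I) ^ (q / 2) • ((I.sort (· ≤ ·)).map psi).prod

/-- The sign `B(I₁,…,I_m) ∈ {±1}` determined by
`ψ_{I₁} ⋯ ψ_{I_m} = B(I₁,…,I_m) 2^{-qm/2} 1`. -/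
def signB {N : ℕ} (q : ℕ) (l : List (Finset (Fin N))) : ℝ :=
  if (l.map (psiSet q)).prod = (((2 : ℂ) ^ (q * l.length / 2))⁻¹) • (1 : Cliff N) then 1 else -1

/-- `b(H) = Σ_{(I₁,…,I_m) ∈ w(H)} B(I₁,…,I_m)` for a multi-hypergraph with
multiplicity function `r` and total multiplicity `m`, the sum running over
all ordered sequences in which each hyperedge `e` appears exactly `r e` times. -/
def bMulti {N : ℕ} (q : ℕ) (r : Finset (Fin N) → ℕ) (m : ℕ) : ℝ :=
  ∑ f : Fin m → Finset (Fin N),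
    if (∀ e, (Finset.univ.filter (fun i => f i = e)).card = r e)
    then signB q (List.ofFn f) else 0

section SortSign

variable {A R : Type*} [LinearOrder A] [Ring R]

/-- The product of the signs `s x y` over all inversions of a list. -/
def sortSign (s : A → A → ℤ) : List A → ℤ
  | [] => 1
  | x :: l => (l.map fun y => if y < x then s x y else 1).prod * sortSign s l

lemma mul_prod_eq_orderedInsert {s : A → A → ℤ} {a : A → R}
    (hs : ∀ x y, a x * a y = s x y • (a y * a x)) (x : A) (L : List A)
    (hL : L.Pairwise (· ≤ ·)) :
    a x * (L.map a).prod = (L.map fun y => if y < x then s x y else 1).prod •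
      ((L.orderedInsert (· ≤ ·) x).map a).prod := by
  induction L with
  | nil => simp
  | cons y L ih =>
    rw [List.pairwise_cons] at hL
    by_cases hxy : x ≤ y
    · have h1 : ∀ z ∈ (y :: L), ¬ z < x := by
        intro z hz
        rcases List.mem_cons.1 hz with rfl | hz
        · exact not_lt.2 hxy
        · exact not_lt.2 (hxy.trans (hL.1 z hz))
      have h2 : ((y :: L).map fun y => if y < x then s x y else 1).prod = 1 := by
        apply List.prod_eq_one
        intro z hz
        obtain ⟨w, hw, rfl⟩ := List.mem_map.1 hz
        exact if_neg (h1 w hw)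
      rw [h2, List.orderedInsert_cons_of_le _ _ hxy]
      simp
    · rw [List.orderedInsert_of_not_le _ _ hxy]
      simp only [List.map_cons, List.prod_cons, if_pos (not_le.1 hxy)]
      rw [← mul_assoc, hs, smul_mul_assoc, mul_assoc, ih hL.2, mul_smul_comm, smul_smul]

lemma prod_eq_sortSign_smul {s : A → A → ℤ} {a : A → R}
    (hs : ∀ x y, a x * a y = s x y • (a y * a x)) (l : List A) :
    (l.map a).prod = sortSign s l • ((l.insertionSort (· ≤ ·)).map a).prod := by
  induction l with
  | nil => simp [sortSign]
  | cons x l ih =>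
    rw [List.map_cons, List.prod_cons, ih, mul_smul_comm,
      mul_prod_eq_orderedInsert hs x _ (List.pairwise_insertionSort (· ≤ ·) l), smul_smul,
      List.insertionSort_cons, sortSign, mul_comm]
    congr 2
    exact ((List.perm_insertionSort (· ≤ ·) l).map _).prod_eq

lemma prod_sorted_of_even_count {a : A → R} {c : R} (l : List A) (hl : l.Pairwise (· ≤ ·))
    (hc : ∀ x, Even (l.count x)) (ha : ∀ x ∈ l, a x * a x = c) :
    (l.map a).prod = c ^ (l.length / 2) := by
  induction hk : l.length using Nat.strong_induction_on generalizing l with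
  | _ k ih =>
  match l with
  | [] => simp at hk; simp [← hk]
  | [x] => exact absurd (hc x) (by simp)
  | x :: y :: l =>
    have hxy : x = y := by
      by_contra hne
      rw [List.pairwise_cons, List.pairwise_cons] at hl
      have h0 : x ∉ l := fun hx =>
        hne (le_antisymm (hl.1 y (by simp)) (hl.2.1 x hx))
      have := hc x
      rw [List.count_cons_self, List.count_cons_of_ne (Ne.symm hne),
        List.count_eq_zero_of_not_mem h0] at this
      simp at this
    subst hxy
    have h1 := ih l.length (by simp at hk; omega) l
      (by rw [List.pairwise_cons, List.pairwise_cons] at hl; exact hl.2.2)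
      (fun z => by
        have := hc z
        rw [List.count_cons, List.count_cons, add_assoc, Nat.even_add] at this
        exact this.2 (by split_ifs <;> simp))
      (fun z hz => ha z (by simp [hz])) rfl
    have h2 : k / 2 = l.length / 2 + 1 := by simp at hk; omega
    rw [h2, List.map_cons, List.map_cons, List.prod_cons, List.prod_cons, ← mul_assoc,
      ha x (by simp), h1, pow_succ']

lemma prod_of_even_count {s : A → A → ℤ} {a : A → R} {c : R}
    (hs : ∀ x y, a x * a y = s x y • (a y * a x)) (l : List A)
    (hc : ∀ x, Even (l.count x)) (ha : ∀ x ∈ l, a x * a x = c) :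
    (l.map a).prod = sortSign s l • c ^ (l.length / 2) := by
  rw [prod_eq_sortSign_smul hs, prod_sorted_of_even_count (c := c) _
    (List.pairwise_insertionSort (· ≤ ·) l)
    (fun x => by rw [(List.perm_insertionSort (· ≤ ·) l).count_eq]; exact hc x)
    (fun x hx => ha x ((List.mem_insertionSort _).1 hx)), List.length_insertionSort]

lemma sortSign_ofFn (s : A → A → ℤ) {m : ℕ} (f : Fin m → A) :
    sortSign s (List.ofFn f) =
      ∏ i, ∏ j, if i < j then (if f j < f i then s (f i) (f j) else 1) else 1 := by
  induction m with
  | zero => simp [sortSign]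
  | succ m ih =>
    rw [List.ofFn_succ, sortSign, ih]
    simp [Fin.prod_univ_succ, List.map_ofFn, List.prod_ofFn]

end SortSign

lemma prod_sym2_filter_not_isDiag {A M : Type*} [LinearOrder A] [CommMonoid M]
    (s : Finset A) (p : Sym2 A → M) :
    ∏ i ∈ s.sym2 with ¬ i.IsDiag, p i = ∏ i ∈ s.offDiag with i.1 < i.2, p s(i.1, i.2) :=
  Additive.ofMul.injective <| by
    rw [ofMul_prod, ofMul_prod]
    convert Finset.sum_sym2_filter_not_isDiag s fun x => Additive.ofMul (p x)

section Majorana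

variable {N : ℕ}

lemma psi_mul_psi (i j : Fin N) :
    psi i * psi j = (if i = j then 1 else -1 : ℤ) • (psi j * psi i) := by
  by_cases h : i = j
  · simp [h]
  · have : (Qf N).IsOrtho (Pi.single i 1) (Pi.single j 1) := by
      rw [QuadraticMap.isOrtho_def]
      simp [Qf, QuadraticMap.weightedSumSquares_apply, mul_add, Finset.sum_add_distrib,
        Pi.single_apply, h, Ne.symm h]
    rw [if_neg h, neg_smul, one_smul]
    exact CliffordAlgebra.ι_mul_ι_comm_of_isOrtho this

lemma psi_mul_self (i : Fin N) : psi i * psi i = (2⁻¹ : ℂ) • (1 : Cliff N) := by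
  rw [psi, CliffordAlgebra.ι_sq_scalar, Algebra.algebraMap_eq_smul_one]
  congr 1
  simp [Qf, QuadraticMap.weightedSumSquares_apply, Pi.single_apply]

lemma mul_list_prod_comm {A R : Type*} [Ring R] {ε : A → A → ℤ} {a : A → R}
    (h : ∀ x y, a x * a y = ε x y • (a y * a x)) (x : A) (L : List A) :
    a x * (L.map a).prod = (L.map (ε x)).prod • ((L.map a).prod * a x) := by
  induction L with
  | nil => simp
  | cons y L ih =>
    simp only [List.map_cons, List.prod_cons]
    rw [← mul_assoc, h, smul_mul_assoc, mul_assoc, ih, mul_smul_comm, smul_smul, mul_assoc]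

lemma list_prod_mul_list_prod_comm {A R : Type*} [Ring R] {ε : A → A → ℤ} {a : A → R}
    (h : ∀ x y, a x * a y = ε x y • (a y * a x)) (K L : List A) :
    (K.map a).prod * (L.map a).prod =
      (K.map fun x => (L.map (ε x)).prod).prod • ((L.map a).prod * (K.map a).prod) := by
  induction K with
  | nil => simp
  | cons x K ih =>
    simp only [List.map_cons, List.prod_cons]
    rw [mul_assoc, ih, mul_smul_comm, ← mul_assoc, mul_list_prod_comm h, smul_mul_assoc, smul_smul,
      mul_assoc, mul_comm (List.prod _)]

lemma list_prod_mul_self (L : List (Fin N)) (hL : L.Nodup) :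
    (L.map psi).prod * (L.map psi).prod =
      ((-1 : ℂ) ^ (L.length.choose 2) * 2⁻¹ ^ L.length) • (1 : Cliff N) := by
  induction L with
  | nil => simp
  | cons x L ih =>
    rw [List.nodup_cons] at hL
    have h1 : L.map (fun j => (if x = j then 1 else -1 : ℤ)) = List.replicate L.length (-1) := by
      rw [List.eq_replicate_iff]
      refine ⟨by simp, fun b hb => ?_⟩
      obtain ⟨j, hj, rfl⟩ := List.mem_map.1 hb
      exact if_neg fun h => hL.1 (by rwa [h])
    have h2 := mul_list_prod_comm psi_mul_psi x L
    rw [h1, List.prod_replicate] at h2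
    have h3 : (L.map psi).prod * psi x = ((-1) ^ L.length : ℤ) • (psi x * (L.map psi).prod) := by
      rw [h2, smul_smul, ← mul_pow]; simp
    rw [List.map_cons, List.prod_cons, mul_assoc, ← mul_assoc (List.prod _), h3, smul_mul_assoc,
      mul_smul_comm, mul_assoc, ih hL.2, mul_smul_comm, mul_smul_comm, mul_one, psi_mul_self,
      ← Int.cast_smul_eq_zsmul ℂ, smul_smul, smul_smul, List.length_cons, Nat.choose_succ_succ',
      Nat.choose_one_right]
    congr 1
    push_cast
    ring

lemma psiSet_mul_self {q : ℕ} (hq : Even q) {I : Finset (Fin N)} (hI : I.card = q) :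
    psiSet q I * psiSet q I = ((2⁻¹ : ℂ) ^ q) • (1 : Cliff N) := by
  obtain ⟨k, rfl⟩ := hq
  rw [psiSet, smul_mul_smul_comm, list_prod_mul_self _ (Finset.sort_nodup _ _), smul_smul,
    Finset.length_sort, hI, ← mul_assoc]
  congr 1
  have h1 : (k + k) / 2 = k := by omega
  have h2 : (k + k).choose 2 = k * (k + k - 1) := by
    rw [Nat.choose_two_right, ← two_mul, mul_assoc, Nat.mul_div_cancel_left _ two_pos]
  rw [h1, h2, ← mul_pow, Complex.I_mul_I, ← pow_add]
  rcases Nat.eq_zero_or_pos k with rfl | hk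
  · simp
  · have : k + k * (k + k - 1) = 2 * (k * k) := by
      obtain ⟨j, rfl⟩ : ∃ j, k = j + 1 := ⟨k - 1, by omega⟩
      have : j + 1 + (j + 1) - 1 = 2 * j + 1 := by omega
      rw [this]; ring
    rw [this, pow_mul]; simp

lemma psiSet_mul_psiSet {q : ℕ} (I J : Finset (Fin N)) :
    psiSet q I * psiSet q J =
      ((-1) ^ (I.card * J.card + (I ∩ J).card) : ℤ) • (psiSet q J * psiSet q I) := by
  have hsort : ∀ (S : Finset (Fin N)) (g : Fin N → ℤ),
      ((S.sort (· ≤ ·)).map g).prod = ∏ i ∈ S, g i := by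
    intro S g
    rw [← List.prod_toFinset _ (Finset.sort_nodup _ _), Finset.sort_toFinset]
  have h1 : ∀ i : Fin N, ∏ j ∈ J, (if i = j then 1 else -1 : ℤ) =
      (-1) ^ J.card * if i ∈ J then -1 else 1 := by
    intro i
    have h3 : ∏ j ∈ J, (if i = j then 1 else -1 : ℤ) =
        (∏ _j ∈ J, (-1 : ℤ)) * ∏ j ∈ J, (if i = j then -1 else 1 : ℤ) := by
      rw [← Finset.prod_mul_distrib]
      exact Finset.prod_congr rfl fun j _ => by split_ifs <;> simp
    rw [h3, Finset.prod_const, Finset.prod_ite_eq]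
  rw [psiSet, psiSet, smul_mul_smul_comm, smul_mul_smul_comm,
    list_prod_mul_list_prod_comm psi_mul_psi, hsort]
  simp_rw [hsort, h1]
  rw [Finset.prod_mul_distrib, Finset.prod_const, ← Finset.prod_filter, Finset.prod_const,
    Finset.filter_mem_eq_inter, ← pow_mul, mul_comm J.card, smul_comm, ← pow_add (-1 : ℤ)]

end Majorana

section Chords

/-- The chord endpoints of a family of hyperedges, two for each of them. -/
abbrev Ends {A : Type*} (E : Finset A) := {e // e ∈ E} ⊕ {e // e ∈ E}

variable {A : Type*} {E : Finset A}

/-- The hyperedge to which an endpoint belongs. -/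
def edgeOf (x : Ends E) : A := Sum.elim Subtype.val Subtype.val x

/-- The two endpoint positions of a hyperedge. -/
def endpoints (U : Ends E → ℝ) (e : A) : ℝ × ℝ :=
  if h : e ∈ E then (U (Sum.inl ⟨e, h⟩), U (Sum.inr ⟨e, h⟩)) else 0

/-- The chord of a hyperedge determined by its endpoint positions. -/
def chords (U : Ends E → ℝ) (e : A) : ℝ × ℝ :=
  (min (endpoints U e).1 (endpoints U e).2, max (endpoints U e).1 (endpoints U e).2)

/-- The positions `0, 1, …` as endpoints, placed according to an enumeration. -/
def place {M : ℕ} (τ : Ends E ≃ Fin M) (x : Ends E) : ℝ := ((τ x : ℕ) : ℝ)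

/-- The product of the sign `t` over the pairs consisting of an entry of `u` and a larger entry
of `v`. -/
def pairProd (t : ℤ) (u v : ℝ × ℝ) : ℤ :=
  (if u.1 < v.1 then t else 1) * (if u.1 < v.2 then t else 1) *
    ((if u.2 < v.1 then t else 1) * (if u.2 < v.2 then t else 1))

lemma K_min_max (a b c d : ℝ) (hac : a ≠ c) (had : a ≠ d) (hbc : b ≠ c) (hbd : b ≠ d) :
    K (min a b, max a b) (min c d, max c d) = pairProd (-1) (a, b) (c, d) := by
  rcases lt_or_gt_of_ne hac with h1 | h1 <;> rcases lt_or_gt_of_ne had with h2 | h2 <;>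
  rcases lt_or_gt_of_ne hbc with h3 | h3 <;> rcases lt_or_gt_of_ne hbd with h4 | h4 <;>
  simp only [K, pairProd, min_lt_iff, lt_min_iff, max_lt_iff, lt_max_iff, h1, h2, h3, h4,
    h1.not_gt, h2.not_gt, h3.not_gt, h4.not_gt] <;> norm_num

lemma pairSign_chords {N : ℕ} {E : Finset (Finset (Fin N))} {U : Ends E → ℝ}
    (hU : Function.Injective U) {e f : Finset (Fin N)} (he : e ∈ E) (hf : f ∈ E) (hne : e ≠ f) :
    pairSign (chords U) s(e, f) =
      pairProd ((-1) ^ (e ∩ f).card) (endpoints U f) (endpoints U e) := by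
  simp only [pairSign, Sym2.lift_mk]
  have hn : (⟨e, he⟩ : {e // e ∈ E}) ≠ ⟨f, hf⟩ := by simpa using hne
  split_ifs with h
  · rw [h.neg_one_pow, K_symm]
    simp only [chords, endpoints, he, hf, dif_pos]
    apply K_min_max <;> apply hU.ne <;> simp [hne.symm]
  · rw [(Nat.not_odd_iff_even.1 h).neg_one_pow]
    simp [pairProd]

lemma BE_chords_congr {N : ℕ} {E : Finset (Finset (Fin N))} {U V : Ends E → ℝ}
    (hU : Function.Injective U) (hV : Function.Injective V)
    (h : ∀ x y, U x < U y ↔ V x < V y) : BE E (chords U) = BE E (chords V) := by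
  refine Finset.prod_congr rfl fun p hp => ?_
  rw [Finset.mem_filter] at hp
  induction p with
  | _ e f =>
    rw [Finset.mk_mem_sym2_iff, Sym2.mk_isDiag_iff] at hp
    rw [pairSign_chords hU hp.1.1 hp.1.2 hp.2, pairSign_chords hV hp.1.1 hp.1.2 hp.2]
    simp only [pairProd, endpoints, hp.1.1, hp.1.2, dif_pos, h]

lemma place_injective {M : ℕ} (τ : Ends E ≃ Fin M) : Function.Injective (place τ) :=
  fun x y h => τ.injective (Fin.ext (by simpa [place] using h))

lemma sortSign_place [LinearOrder A] {M : ℕ} (τ : Ends E ≃ Fin M) (s : A → A → ℤ) :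
    sortSign s (List.ofFn fun i => edgeOf (τ.symm i)) =
      ∏ p ∈ E.offDiag with p.1 < p.2,
        pairProd (s p.2 p.1) (endpoints (place τ) p.2) (endpoints (place τ) p.1) := by
  have h1 : (E.offDiag.filter fun p => p.1 < p.2) = (E ×ˢ E).filter fun p => p.1 < p.2 := by
    ext p
    simp only [Finset.mem_filter, Finset.mem_offDiag, Finset.mem_product]
    exact ⟨fun h => ⟨⟨h.1.1, h.1.2.1⟩, h.2⟩, fun h => ⟨⟨h.1.1, h.1.2, h.2.ne⟩, h.2⟩⟩
  rw [sortSign_ofFn, h1, Finset.prod_filter, Finset.prod_product_right, ← τ.prod_comp]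
  simp_rw [← τ.prod_comp, Equiv.symm_apply_apply, ← Finset.prod_coe_sort E]
  simp only [Fintype.prod_sum_type, ← Finset.prod_mul_distrib]
  refine Finset.prod_congr rfl fun e _ => Finset.prod_congr rfl fun f _ => ?_
  simp only [edgeOf, Sum.elim_inl, Sum.elim_inr, pairProd, endpoints, Finset.coe_mem, dif_pos,
    place, Nat.cast_lt, Fin.val_fin_lt, Subtype.coe_eta]
  by_cases h : (f : A) < e <;> simp [h]

lemma isUnit_sortSign {A : Type*} [LinearOrder A] {s : A → A → ℤ} (hs : ∀ x y, IsUnit (s x y))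
    (l : List A) : IsUnit (sortSign s l) := by
  induction l with
  | nil => simp [sortSign]
  | cons x l ih =>
    refine IsUnit.mul ?_ ih
    refine List.prod_isUnit fun z hz => ?_
    obtain ⟨y, -, rfl⟩ := List.mem_map.1 hz
    split_ifs
    exacts [hs _ _, isUnit_one]

lemma card_edgeOf_fiber {A : Type*} [DecidableEq A] (E : Finset A) (e : A) :
    Nat.card {x : Ends E // edgeOf x = e} = if e ∈ E then 2 else 0 := by
  have h : ∑ x : {e // e ∈ E}, (if (x : A) = e then 1 else 0) = if e ∈ E then 1 else 0 :=
    (Finset.sum_coe_sort E fun x => if x = e then 1 else 0).trans (Finset.sum_ite_eq' _ _ _)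
  rw [Nat.card_eq_fintype_card, Fintype.card_subtype, Finset.card_filter, Fintype.sum_sum_type]
  exact (congrArg₂ (· + ·) h h).trans (by split_ifs <;> rfl)

lemma card_ends (E : Finset A) : Fintype.card (Ends E) = 2 * E.card := by
  simp [two_mul]

lemma even_count_edgeOf [DecidableEq A] {M : ℕ} (τ : Ends E ≃ Fin M) (e : A) :
    Even ((List.ofFn fun i => edgeOf (τ.symm i)).count e) := by
  have h : (List.ofFn fun i => edgeOf (τ.symm i)).count e =
      Nat.card {x : Ends E // edgeOf x = e} := by
    rw [← Multiset.coe_count, ← Fin.univ_val_map, Multiset.count_map, ← Finset.filter_val,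
      Finset.card_val, ← Fintype.card_subtype, ← Nat.card_eq_fintype_card]
    exact Nat.card_congr (τ.symm.subtypeEquiv fun i => eq_comm)
  rw [h, card_edgeOf_fiber]
  split_ifs <;> simp

lemma edgeOf_mem (x : Ends E) : edgeOf x ∈ E := by
  rcases x with x | x <;> exact x.2

lemma exists_prod_place_eq {R : Type*} [Ring R] [LinearOrder A] {s : A → A → ℤ} {a : A → R}
    {c : R} (hs : ∀ x y, a x * a y = s x y • (a y * a x)) (hunit : ∀ x y, IsUnit (s x y))
    (ha : ∀ e ∈ E, a e * a e = c) (τ : Ends E ≃ Fin (2 * E.card)) :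
    ∃ D : ℤ, IsUnit D ∧
      ((List.ofFn fun i => edgeOf (τ.symm i)).map a).prod = D • c ^ E.card ∧
      D = ∏ p ∈ E.offDiag with p.1 < p.2,
        pairProd (s p.2 p.1) (endpoints (place τ) p.2) (endpoints (place τ) p.1) := by
  refine ⟨_, isUnit_sortSign hunit _, ?_, sortSign_place τ s⟩
  rw [prod_of_even_count hs _ (even_count_edgeOf τ) (c := c), List.length_ofFn,
    Nat.mul_div_cancel_left _ two_pos]
  intro x hx
  obtain ⟨i, rfl⟩ := List.mem_ofFn.1 hx
  exact ha _ (edgeOf_mem _)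

lemma BE_chords_eq {N : ℕ} {E : Finset (Finset (Fin N))} {q : ℕ} (hq : Even q)
    (hE : ∀ e ∈ E, e.card = q) {U : Ends E → ℝ} (hU : Function.Injective U)
    (lo : LinearOrder (Finset (Fin N))) :
    BE E (chords U) = ((∏ p ∈ E.offDiag with lo.lt p.1 p.2,
      pairProd ((-1) ^ (p.2.card * p.1.card + (p.2 ∩ p.1).card))
        (endpoints U p.2) (endpoints U p.1) : ℤ) : ℝ) := by
  have h := @prod_sym2_filter_not_isDiag _ ℝ lo _ E (pairSign (chords U))
  rw [BE]
  convert h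
  rw [Int.cast_prod]
  refine Finset.prod_congr (by congr!) fun p hp => ?_
  have hp := Finset.mem_offDiag.1 (Finset.mem_filter.1 hp).1
  rw [pairSign_chords hU hp.1 hp.2.1 hp.2.2, pow_add, Finset.inter_comm]
  rw [Even.neg_one_pow (by rw [hE _ hp.1]; exact hq.mul_left _), one_mul]

instance nontrivial_cliff (N : ℕ) : Nontrivial (Cliff N) :=
  letI : Invertible (2 : ℂ) := invertibleOfNonzero two_ne_zero
  inferInstance

lemma signB_place {q N : ℕ} (hq : Even q) {E : Finset (Finset (Fin N))}
    (hE : ∀ e ∈ E, e.card = q) (τ : Ends E ≃ Fin (2 * E.card)) :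
    signB q (List.ofFn fun i => edgeOf (τ.symm i)) = BE E (chords (place τ)) := by
  let lo : LinearOrder (Finset (Fin N)) := linearOrderOfSTO WellOrderingRel
  obtain ⟨D, hD, h1, h2⟩ := @exists_prod_place_eq _ E (Cliff N) _ lo
    (fun I J => (-1) ^ (I.card * J.card + (I ∩ J).card)) (psiSet q) _ psiSet_mul_psiSet
    (fun _ _ => isUnit_one.neg.pow _) (fun e he => psiSet_mul_self hq (hE e he)) τ
  have h3 : BE E (chords (place τ)) = D := by
    rw [h2, BE_chords_eq hq hE (place_injective τ) lo]
  have h4 : (((2⁻¹ : ℂ) ^ q) • (1 : Cliff N)) ^ E.card =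
      ((2 : ℂ) ^ (q * (2 * E.card) / 2))⁻¹ • (1 : Cliff N) := by
    rw [smul_pow, one_pow, ← pow_mul, inv_pow, mul_left_comm, Nat.mul_div_cancel_left _ two_pos]
  rw [h3, signB, h1, List.length_ofFn, h4]
  rcases Int.isUnit_iff.1 hD with rfl | rfl
  · simp
  · rw [if_neg]
    · simp
    · rw [neg_smul, one_smul, neg_eq_iff_add_eq_zero, ← two_smul ℂ, smul_smul,
        smul_eq_zero]
      simp

end Chords

section Symmetrization

/-- The uniform law on the unit interval. -/
def unif : Measure ℝ := volume.restrict (Set.Icc (0 : ℝ) 1)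

instance isProbabilityMeasure_unif : IsProbabilityMeasure unif :=
  ⟨by simp [unif]⟩

lemma measurable_min_max : Measurable fun p : ℝ × ℝ => (min p.1 p.2, max p.1 p.2) := by
  fun_prop

lemma nu_eq_map : nu = (unif.prod unif).map fun p => (min p.1 p.2, max p.1 p.2) := by
  rw [nu, unif, Measure.prod_restrict, Measure.volume_eq_prod]

instance isProbabilityMeasure_nu : IsProbabilityMeasure nu := by
  rw [nu_eq_map]
  exact Measure.isProbabilityMeasure_map measurable_min_max.aemeasurable

lemma ae_injective_pi_unif (F : Type*) [Fintype F] :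
    ∀ᵐ U ∂(Measure.pi fun _ : F => unif), Function.Injective U := by
  have h : ∀ a b : F, a ≠ b → ∀ᵐ U ∂(volume : Measure (F → ℝ)), U a ≠ U b := by
    intro a b hab
    let S : Submodule ℝ (F → ℝ) :=
      LinearMap.ker ((LinearMap.proj a : (F → ℝ) →ₗ[ℝ] ℝ) - LinearMap.proj b)
    have hS : S ≠ ⊤ := by
      intro h
      have h1 : (Pi.single a 1 : F → ℝ) ∈ S := h ▸ Submodule.mem_top
      simp [S, LinearMap.mem_ker, hab.symm] at h1
    have h2 := Measure.addHaar_submodule volume S hS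
    rw [ae_iff]
    convert h2 using 2
    ext U
    simp [S, LinearMap.mem_ker, sub_eq_zero]
  have h' : ∀ᵐ U ∂(volume : Measure (F → ℝ)), ∀ a b : F, a ≠ b → U a ≠ U b := by
    simp only [ae_all_iff]
    exact h
  have hpi : (Measure.pi fun _ : F => unif) =
      (volume : Measure (F → ℝ)).restrict (Set.univ.pi fun _ => Set.Icc 0 1) := by
    rw [volume_pi, Measure.restrict_pi_pi]
    rfl
  rw [hpi]
  filter_upwards [ae_restrict_of_ae h'] with U hU a b hab
  by_contra hne
  exact hU a b hne hab

lemma exists_equiv_fin_lt_iff {F : Type*} [Fintype F] {M : ℕ} (hM : Fintype.card F = M)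
    {U : F → ℝ} (hU : Function.Injective U) : ∃ τ : F ≃ Fin M, ∀ x y, U x < U y ↔ τ x < τ y := by
  let _ : LinearOrder F := LinearOrder.lift' U hU
  exact ⟨(monoEquivOfFin F hM).symm.toEquiv, fun x y =>
    ((monoEquivOfFin F hM).symm.lt_iff_lt (x := x) (y := y)).symm⟩

lemma factorial_mul_integral_eq_sum {F : Type*} [Fintype F] [DecidableEq F] {M : ℕ} (hM : Fintype.card F = M)
    {G : (F → ℝ) → ℝ} (hmeas : Measurable G) {C : ℝ} (hC : ∀ U, |G U| ≤ C)
    (hG : ∀ U V : F → ℝ, Function.Injective U → Function.Injective V →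
      (∀ x y, U x < U y ↔ V x < V y) → G U = G V) :
    (M.factorial : ℝ) * ∫ U, G U ∂(Measure.pi fun _ => unif) =
      ∑ τ : F ≃ Fin M, G fun x => ((τ x : ℕ) : ℝ) := by
  set μ : Measure (F → ℝ) := Measure.pi fun _ => unif
  have hperm : ∀ π : Equiv.Perm F, MeasurePreserving (fun U : F → ℝ => U ∘ π) μ μ := by
    intro π
    have := measurePreserving_arrowCongr' (fun _ : F => unif) (fun _ : F => unif) π.symm
      (MeasurableEquiv.refl ℝ) (fun _ => MeasurePreserving.id unif)
    exact this
  have h1 : ∀ π : Equiv.Perm F, ∫ U, G (U ∘ π) ∂μ = ∫ U, G U ∂μ := by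
    intro π
    conv_rhs => rw [← (hperm π).map_eq]
    rw [integral_map (hperm π).measurable.aemeasurable hmeas.aestronglyMeasurable]
  have h2 : ∀ π : Equiv.Perm F, Integrable (fun U => G (U ∘ π)) μ := fun π =>
    Integrable.of_bound (hmeas.comp (hperm π).measurable).aestronglyMeasurable C
      (ae_of_all _ fun U => hC _)
  have h3 : ∀ᵐ U ∂μ, ∑ π : Equiv.Perm F, G (U ∘ π) =
      ∑ τ : F ≃ Fin M, G fun x => ((τ x : ℕ) : ℝ) := by
    filter_upwards [ae_injective_pi_unif F] with U hU
    obtain ⟨τ, hτ⟩ := exists_equiv_fin_lt_iff hM hU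
    refine Fintype.sum_equiv (Equiv.equivCongr (Equiv.refl F) τ) _ _ fun π => ?_
    refine hG _ _ (hU.comp π.injective) ?_ fun x y => ?_
    · intro x y h
      exact (Equiv.equivCongr (Equiv.refl F) τ π).injective (Fin.ext (Nat.cast_injective h))
    · simp [hτ]
  calc (M.factorial : ℝ) * ∫ U, G U ∂μ = ∑ π : Equiv.Perm F, ∫ U, G (U ∘ π) ∂μ := by
        simp [h1, Fintype.card_perm, hM]
    _ = ∫ U, ∑ π : Equiv.Perm F, G (U ∘ π) ∂μ := (integral_finsetSum _ fun π _ => h2 π).symm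
    _ = ∫ _U, ∑ τ : F ≃ Fin M, G (fun x => ((τ x : ℕ) : ℝ)) ∂μ := integral_congr_ae h3
    _ = _ := by simp [μ]

end Symmetrization

section Expectation

variable {N : ℕ} (E : Finset (Finset (Fin N)))

lemma measurable_K : Measurable fun p : (ℝ × ℝ) × (ℝ × ℝ) => K p.1 p.2 := by
  unfold K
  have h₁ : Measurable fun p : (ℝ × ℝ) × (ℝ × ℝ) => p.1.1 := by fun_prop
  have h₂ : Measurable fun p : (ℝ × ℝ) × (ℝ × ℝ) => p.1.2 := by fun_prop
  have h₃ : Measurable fun p : (ℝ × ℝ) × (ℝ × ℝ) => p.2.1 := by fun_prop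
  have h₄ : Measurable fun p : (ℝ × ℝ) × (ℝ × ℝ) => p.2.2 := by fun_prop
  exact Measurable.ite
    (((measurableSet_lt h₁ h₃).inter ((measurableSet_lt h₃ h₂).inter (measurableSet_lt h₂ h₄))).union
      ((measurableSet_lt h₃ h₁).inter ((measurableSet_lt h₁ h₄).inter (measurableSet_lt h₄ h₂))))
    measurable_const measurable_const

lemma measurable_BE : Measurable (BE E) := by
  refine Finset.measurable_fun_prod _ fun p _ => ?_
  induction p with
  | _ e f =>
    simp only [pairSign, Sym2.lift_mk]
    split_ifs
    · change Measurable ((fun p : (ℝ × ℝ) × (ℝ × ℝ) => K p.1 p.2) ∘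
        fun X : Finset (Fin N) → ℝ × ℝ => (X e, X f))
      exact measurable_K.comp ((measurable_pi_apply e).prodMk (measurable_pi_apply f))
    · exact measurable_const

lemma abs_BE (X : Finset (Fin N) → ℝ × ℝ) : |BE E X| = 1 := by
  rw [BE, Finset.abs_prod]
  refine Finset.prod_eq_one fun p _ => ?_
  induction p with
  | _ e f =>
    simp only [pairSign, Sym2.lift_mk, K]
    split_ifs <;> simp

variable {E}

lemma BE_congr {X Y : Finset (Fin N) → ℝ × ℝ} (h : ∀ e ∈ E, X e = Y e) : BE E X = BE E Y := by
  refine Finset.prod_congr rfl fun p hp => ?_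
  rw [Finset.mem_filter] at hp
  induction p with
  | _ e f =>
    rw [Finset.mk_mem_sym2_iff] at hp
    simp only [pairSign, Sym2.lift_mk, h e hp.1.1, h f hp.1.2]

lemma measurable_chords : Measurable (chords : (Ends E → ℝ) → Finset (Fin N) → ℝ × ℝ) := by
  refine measurable_pi_lambda _ fun e => ?_
  have h : Measurable fun U : Ends E → ℝ => endpoints U e := by
    unfold endpoints
    split_ifs <;> fun_prop
  exact measurable_min_max.comp h

variable (E)

lemma bT_eq_integral_chords :
    bT E = ∫ U : Ends E → ℝ, BE E (chords U) ∂(Measure.pi fun _ => unif) := by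
  let ext (Y : {e // e ∈ E} → ℝ × ℝ) (e : Finset (Fin N)) : ℝ × ℝ :=
    if h : e ∈ E then Y ⟨e, h⟩ else 0
  have hext : Measurable ext := by
    refine measurable_pi_lambda _ fun e => ?_
    simp only [ext]
    split_ifs <;> fun_prop
  have hmeas : Measurable fun Y => BE E (ext Y) := (measurable_BE E).comp hext
  have h1 : MeasurePreserving (fun (X : Finset (Fin N) → ℝ × ℝ) (e : {e // e ∈ E}) => X e)
      (Measure.pi fun _ => nu) (Measure.pi fun _ => nu) := by
    convert measurePreserving_fst.comp
      (measurePreserving_piEquivPiSubtypeProd (fun _ : Finset (Fin N) => nu) (· ∈ E))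
    rfl
  have h2 : MeasurePreserving (fun (U : Ends E → ℝ) (e : {e // e ∈ E}) =>
        (min (U (Sum.inl e)) (U (Sum.inr e)), max (U (Sum.inl e)) (U (Sum.inr e))))
      (Measure.pi fun _ => unif) (Measure.pi fun _ => nu) :=
    (measurePreserving_pi (fun _ : {e // e ∈ E} => unif.prod unif) (fun _ => nu)
      (f := fun _ p => (min p.1 p.2, max p.1 p.2))
      fun _ => ⟨measurable_min_max, nu_eq_map.symm⟩).comp
    (((measurePreserving_arrowProdEquivProdArrow ℝ ℝ {e // e ∈ E} (fun _ => unif)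
      (fun _ => unif)).symm _).comp
      (measurePreserving_sumPiEquivProdPi (fun _ : Ends E => unif)))
  calc bT E = ∫ X : Finset (Fin N) → ℝ × ℝ, BE E (ext fun e => X e) ∂(Measure.pi fun _ => nu) :=
        integral_congr_ae (ae_of_all _ fun X => BE_congr fun e he => by simp [ext, he])
    _ = ∫ Y, BE E (ext Y) ∂(Measure.pi fun _ => nu) := by
        rw [← h1.map_eq, integral_map h1.measurable.aemeasurable hmeas.aestronglyMeasurable]
    _ = ∫ U : Ends E → ℝ, BE E (ext fun e => (min (U (Sum.inl e)) (U (Sum.inr e)),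
          max (U (Sum.inl e)) (U (Sum.inr e)))) ∂(Measure.pi fun _ => unif) := by
        rw [← h2.map_eq, integral_map h2.measurable.aemeasurable hmeas.aestronglyMeasurable]
    _ = _ := integral_congr_ae (ae_of_all _ fun U => BE_congr fun e he => by
        simp [ext, chords, endpoints, he])

lemma factorial_mul_bT [DecidableEq (Ends E)] :
    ((2 * E.card).factorial : ℝ) * bT E =
      ∑ τ : Ends E ≃ Fin (2 * E.card), BE E (chords (place τ)) := by
  rw [bT_eq_integral_chords]
  exact factorial_mul_integral_eq_sum (G := fun U => BE E (chords U)) (card_ends E) ((measurable_BE E).comp measurable_chords)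
    (fun U => (abs_BE E _).le) fun _ _ hU hV h => BE_chords_congr hU hV h

end Expectation

section Counting

lemma card_equiv_comp_symm_eq {F B : Type*} [Fintype F] [Fintype B] {M : ℕ} (g : F → B)
    (f : Fin M → B) (h : ∀ b, Nat.card {i // f i = b} = Nat.card {x // g x = b}) :
    Nat.card {τ : F ≃ Fin M // (fun i => g (τ.symm i)) = f} =
      ∏ b, (Nat.card {x // g x = b}).factorial := by
  have e : ∀ b, {x // g x = b} ≃ {i // f i = b} := fun b => (Finite.card_eq.1 (h b).symm).some
  let τ := Equiv.ofFiberEquiv e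
  have hτ : ∀ x, f (τ x) = g x := Equiv.ofFiberEquiv_map e
  have hg := DomMulAct.stabilizer_card g
  simp only [← Nat.card_eq_fintype_card] at hg
  rw [← hg]
  refine Nat.card_congr
    ((Equiv.equivCongr (Equiv.refl F) τ.symm).subtypeEquiv fun σ => ?_)
  simp only [funext_iff, Function.comp_apply, Equiv.equivCongr_apply_apply, Equiv.refl_symm,
    Equiv.refl_apply]
  have h1 : ∀ i, g (τ.symm i) = f i := fun i => by rw [← hτ, Equiv.apply_symm_apply]
  simp only [h1]
  exact ⟨fun h x => by rw [← h, Equiv.symm_apply_apply],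
    fun h i => by rw [← h, Equiv.apply_symm_apply]⟩

lemma sum_place_eq {B : Type*} [Fintype B] (E : Finset B) [DecidableEq (Ends E)]
    (H : (Fin (2 * E.card) → B) → ℝ) :
    ∑ τ : Ends E ≃ Fin (2 * E.card), H (fun i => edgeOf (τ.symm i)) =
      2 ^ E.card * ∑ f : Fin (2 * E.card) → B,
        if (∀ e, (Finset.univ.filter (fun i => f i = e)).card = if e ∈ E then 2 else 0)
        then H f else 0 := by
  have h1 : ∀ τ : Ends E ≃ Fin (2 * E.card), H (fun i => edgeOf (τ.symm i)) =
      ∑ f, if (fun i => edgeOf (τ.symm i)) = f then H f else 0 := fun τ => by simp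
  simp_rw [h1]
  rw [Finset.sum_comm, Finset.mul_sum]
  refine Finset.sum_congr rfl fun f _ => ?_
  rw [← Finset.sum_filter, Finset.sum_const, nsmul_eq_mul, ← Fintype.card_subtype,
    ← Nat.card_eq_fintype_card]
  split_ifs with hf
  · rw [card_equiv_comp_symm_eq edgeOf f fun b => by
      rw [card_edgeOf_fiber, ← hf b, Nat.card_eq_fintype_card,
        Fintype.card_subtype]]
    simp_rw [card_edgeOf_fiber, apply_ite Nat.factorial, Finset.prod_ite]
    simp
  · rw [mul_zero, mul_eq_zero]
    left
    rw [Nat.cast_eq_zero, Finite.card_eq_zero_iff]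
    refine ⟨fun ⟨τ, hτ⟩ => hf fun e => ?_⟩
    rw [← card_edgeOf_fiber, ← Fintype.card_subtype, ← Nat.card_eq_fintype_card, ← hτ]
    exact Nat.card_congr (τ.symm.subtypeEquiv fun i => Iff.rfl)

end Counting

/-- For a simple `q`-uniform hypergraph `T` on `{1,…,v}` (`v ≤ n`) and
`T₂` the multi-hypergraph giving every hyperedge multiplicity `2` (so `m(T₂) = 2|E|`),
`b(T₂) = b_T · m(T₂)!/2^{m(T₂)/2}`. -/
theorem bMulti_double_eq (q n : ℕ) (hq : Even q) (hq2 : 2 ≤ q) (hn : q ≤ n)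
    (v : ℕ) (hv : v ≤ n) (E : Finset (Finset (Fin n)))
    (hE : ∀ e ∈ E, e.card = q ∧ ∀ i ∈ e, (i : ℕ) < v) :
    bMulti q (fun e => if e ∈ E then 2 else 0) (2 * E.card)
      = bT E * ((2 * E.card).factorial : ℝ) / 2 ^ E.card := by
  rw [eq_div_iff (by positivity), mul_comm (bT E), factorial_mul_bT, bMulti, mul_comm]
  have h := sum_place_eq E fun f => signB q (List.ofFn f)
  convert h.symm.trans ?_
  exact Finset.sum_congr rfl fun τ _ => signB_place hq (fun e he => (hE e he).1) τ

end SYK
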